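/- arXiv:1902.04389 — 2 statements merged into one kernel-verified Lean document; each statement's English description precedes it below -/
import Mathlib

section
/- Let r ≥ 0 be an integer, I a subset of {0,1,…,r}, and let i < k be elements of I. For i ≤ j ≤ k define A_{i,j} := {(t_{i+1},…,t_j) ∈ [0,1]^{j−i} : t_{i+1} > t_{i+2} > ⋯ > t_j} and B_{j,k} := {(t_{j+1},…,t_k) ∈ [0,1]^{k−j} : for every j < m < k, t_m > t_{m+1} if m ∉ I and t_m < t_{m+1} if m ∈ I}. Set I_0 := {j ∈ I : i ≤ j ≤ k and |I ∩ {j+1,…,k}| is even} and I_1 := {j ∈ I : i ≤ j ≤ k and |I ∩ {j+1,…,k}| is odd}. Then for every point t = (t_{i+1},…,t_k) ∈ [0,1]^{k−i} whose coordinates are pairwise distinct, t belongs to ⋃_{j∈I_0} (A_{i,j} × B_{j,k}) if and only if t belongs to ⋃_{j∈I_1} (A_{i,j} × B_{j,k}). -/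
open Filter Finset Asymptotics

/-- Every element of `I` below `k ∈ I` has a successor in `I`, and that successor is at most `k`. -/
theorem exists_next_mem {I : Finset ℕ} {j k : ℕ} (hk : k ∈ I) (hjk : j < k) :
    ∃ l ∈ I, j < l ∧ l ≤ k ∧ ∀ m, j < m → m < l → m ∉ I := by
  classical
  have h : ∃ l, l ∈ I ∧ j < l := ⟨k, hk, hjk⟩
  exact ⟨Nat.find h, (Nat.find_spec h).1, (Nat.find_spec h).2, Nat.find_min' h ⟨hk, hjk⟩,
    fun m hjm hml hm => Nat.find_min h hml ⟨hm, hjm⟩⟩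

/-- Every element of `I` above `i ∈ I` has a predecessor in `I`, and that predecessor is at
least `i`. -/
theorem exists_prev_mem {I : Finset ℕ} {i j : ℕ} (hi : i ∈ I) (hij : i < j) :
    ∃ l ∈ I, i ≤ l ∧ l < j ∧ ∀ m, l < m → m < j → m ∉ I := by
  classical
  have hne : i ∈ I.filter (· < j) := Finset.mem_filter.2 ⟨hi, hij⟩
  obtain ⟨l, hl, hmax⟩ := Finset.exists_max_image (I.filter (· < j)) id ⟨i, hne⟩
  rw [Finset.mem_filter] at hl
  refine ⟨l, hl.1, hmax i hne, hl.2, fun m hlm hmj hm => ?_⟩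
  exact absurd (hmax m (Finset.mem_filter.2 ⟨hm, hmj⟩)) (not_le.2 hlm)

theorem card_inter_Icc_of_consecutive {I : Finset ℕ} {j l k : ℕ} (hl : l ∈ I) (hjl : j < l)
    (hlk : l ≤ k) (h : ∀ m, j < m → m < l → m ∉ I) :
    (I ∩ Finset.Icc (j + 1) k).card = (I ∩ Finset.Icc (l + 1) k).card + 1 := by
  have heq : I ∩ Finset.Icc (j + 1) k = insert l (I ∩ Finset.Icc (l + 1) k) := by
    ext m
    simp only [Finset.mem_inter, Finset.mem_Icc, Finset.mem_insert]
    constructor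
    · rintro ⟨hm, h₁, h₂⟩
      by_cases hml : m < l
      · exact absurd hm (h m (by omega) hml)
      · by_cases hm' : m = l
        · exact Or.inl hm'
        · exact Or.inr ⟨hm, by omega, h₂⟩
    · rintro (rfl | ⟨hm, h₁, h₂⟩)
      · exact ⟨hl, by omega, hlk⟩
      · exact ⟨hm, by omega, h₂⟩
  rw [heq, Finset.card_insert_of_notMem]
  simp

/-- `t` lies in `A_{i,j} × B_{j,k}`, where `T` gives the coordinates of `t`. -/
def IsCutPoint (I : Finset ℕ) (i k : ℕ) (T : ℕ → ℝ) (j : ℕ) : Prop :=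
  (∀ m : ℕ, i + 1 ≤ m → m + 1 ≤ j → T (m + 1) < T m) ∧
    (∀ m : ℕ, j + 1 ≤ m → m + 1 ≤ k →
      if m ∈ I then T m < T (m + 1) else T (m + 1) < T m)

theorem IsCutPoint.next {I : Finset ℕ} {i j k l : ℕ} {T : ℕ → ℝ} (h : IsCutPoint I i k T j)
    (hjl : j < l) (hlk : l ≤ k) (hI : ∀ m, j < m → m < l → m ∉ I)
    (hj : i < j → T (j + 1) < T j) : IsCutPoint I i k T l := by
  refine ⟨fun m him hml => ?_, fun m hlm hmk => h.2 m (by omega) hmk⟩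
  rcases lt_trichotomy m j with hmj | rfl | hjm
  · exact h.1 m him hmj
  · exact hj him
  · simpa [hI m hjm hml] using h.2 m hjm (by omega)

theorem IsCutPoint.prev {I : Finset ℕ} {i j k l : ℕ} {T : ℕ → ℝ} (h : IsCutPoint I i k T j)
    (hjI : j ∈ I) (hil : i ≤ l) (hlj : l < j) (hI : ∀ m, l < m → m < j → m ∉ I)
    (hj : j < k → T j < T (j + 1)) : IsCutPoint I i k T l := by
  refine ⟨fun m him hml => h.1 m him (by omega), fun m hlm hmk => ?_⟩
  rcases lt_trichotomy m j with hmj | rfl | hjm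
  · simpa [hI m hlm hmj] using h.1 m (by omega) hmj
  · simpa [hjI] using hj hmk
  · exact h.2 m hjm hmk

/-- Moving to the next or the previous element of `I` turns a cut point into one of the
opposite parity. -/
theorem IsCutPoint.exists_neighbor {I : Finset ℕ} {i j k : ℕ} {T : ℕ → ℝ}
    (hi : i ∈ I) (hk : k ∈ I) (hik : i < k)
    (hne : ∀ m, i < m → m < k → T m ≠ T (m + 1))
    (h : IsCutPoint I i k T j) (hjI : j ∈ I) (hij : i ≤ j) (hjk : j ≤ k) :
    ∃ l ∈ I, i ≤ l ∧ l ≤ k ∧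
      ((I ∩ Finset.Icc (j + 1) k).card = (I ∩ Finset.Icc (l + 1) k).card + 1 ∨
        (I ∩ Finset.Icc (l + 1) k).card = (I ∩ Finset.Icc (j + 1) k).card + 1) ∧
      IsCutPoint I i k T l := by
  by_cases hnext : j < k ∧ (i < j → T (j + 1) < T j)
  · obtain ⟨l, hl, hjl, hlk, hgap⟩ := exists_next_mem hk hnext.1
    exact ⟨l, hl, by omega, hlk, Or.inl (card_inter_Icc_of_consecutive hl hjl hlk hgap),
      h.next hjl hlk hgap hnext.2⟩
  · have hlt : i < j := by
      by_contra hle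
      exact hnext ⟨by omega, fun hlt => absurd hlt hle⟩
    obtain ⟨l, hl, hil, hlj, hgap⟩ := exists_prev_mem hi hlt
    refine ⟨l, hl, hil, by omega, Or.inr (card_inter_Icc_of_consecutive hjI hlj hjk hgap),
      h.prev hjI hil hlj hgap fun hjk' => ?_⟩
    refine lt_of_le_of_ne (not_lt.1 fun hlt' => hnext ⟨hjk', fun _ => hlt'⟩) (hne j hlt hjk')

/-- let `i < k` in `I ⊆ {0,…,r}`, and let `T` give the coordinates
`t_{i+1},…,t_k ∈ [0,1]`, pairwise distinct. For `i ≤ j ≤ k`, membership of `t` in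
`A_{i,j} × B_{j,k}` means: `t_{i+1} > ⋯ > t_j` and, for `j < m < k`, `t_m > t_{m+1}`
if `m ∉ I` while `t_m < t_{m+1}` if `m ∈ I`. Then `t` lies in the union of the
`A_{i,j} × B_{j,k}` over `j ∈ I` with `|I ∩ {j+1,…,k}|` even if and only if it lies in
the corresponding union over `j ∈ I` with `|I ∩ {j+1,…,k}|` odd. -/
theorem interlacing_unions (r : ℕ) (I : Finset ℕ) (hI : ∀ m ∈ I, m ≤ r)
    (i k : ℕ) (hi : i ∈ I) (hk : k ∈ I) (hik : i < k)
    (T : ℕ → ℝ)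
    (hT01 : ∀ m : ℕ, i + 1 ≤ m → m ≤ k → T m ∈ Set.Icc (0 : ℝ) 1)
    (hdist : ∀ m m' : ℕ, i + 1 ≤ m → m < m' → m' ≤ k → T m ≠ T m') :
    (∃ j ∈ I, i ≤ j ∧ j ≤ k ∧ Even ((I ∩ Finset.Icc (j + 1) k).card) ∧
      (∀ m : ℕ, i + 1 ≤ m → m + 1 ≤ j → T (m + 1) < T m) ∧
      (∀ m : ℕ, j + 1 ≤ m → m + 1 ≤ k →
        if m ∈ I then T m < T (m + 1) else T (m + 1) < T m)) ↔
    (∃ j ∈ I, i ≤ j ∧ j ≤ k ∧ Odd ((I ∩ Finset.Icc (j + 1) k).card) ∧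
      (∀ m : ℕ, i + 1 ≤ m → m + 1 ≤ j → T (m + 1) < T m) ∧
      (∀ m : ℕ, j + 1 ≤ m → m + 1 ≤ k →
        if m ∈ I then T m < T (m + 1) else T (m + 1) < T m)) := by
  have hne : ∀ m, i < m → m < k → T m ≠ T (m + 1) := fun m him hmk =>
    hdist m (m + 1) him (Nat.lt_succ_self m) hmk
  constructor
  · rintro ⟨j, hj, hij, hjk, hpar, hcut⟩
    obtain ⟨l, hl, hil, hlk, hcard, hcut'⟩ :=
      IsCutPoint.exists_neighbor hi hk hik hne hcut hj hij hjk
    exact ⟨l, hl, hil, hlk, by grind, hcut'⟩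
  · rintro ⟨j, hj, hij, hjk, hpar, hcut⟩
    obtain ⟨l, hl, hil, hlk, hcard, hcut'⟩ :=
      IsCutPoint.exists_neighbor hi hk hik hne hcut hj hij hjk
    exact ⟨l, hl, hil, hlk, by grind, hcut'⟩
end

section
/- Let φ : A → B be a homomorphism of commutative rings making B a faithfully flat A-module. Let a ∈ A be a non-zero-divisor of A and let b ∈ B. If φ(a)·b lies in the image φ(A), then b lies in the image φ(A). -/
/-- let `φ : A → B` be a ring homomorphism making `B` a faithfully flat
`A`-module, `a ∈ A` a non-zero-divisor and `b ∈ B`. If `φ a * b` lies in the image of `φ`,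
then so does `b`. -/
theorem mem_range_of_mul_mem_range_of_faithfullyFlat
    {A B : Type*} [CommRing A] [CommRing B] (φ : A →+* B)
    (hff : letI := φ.toAlgebra; Module.FaithfullyFlat A B)
    (a : A) (ha : Function.Injective fun x : A => a * x)
    (b : B) (hab : φ a * b ∈ Set.range φ) :
    b ∈ Set.range φ := by
  algebraize [φ]
  have : Module.FaithfullyFlat A B := hff
  obtain ⟨c, hc⟩ := hab
  have hmem : c ∈ Ideal.span {a} := by
    rw [← Ideal.comap_map_eq_self_of_faithfullyFlat (B := B) (Ideal.span {a}), Ideal.mem_comap,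
      Ideal.map_span, Set.image_singleton, Ideal.mem_span_singleton]
    exact ⟨b, hc⟩
  obtain ⟨d, rfl⟩ := Ideal.mem_span_singleton.mp hmem
  have hreg : IsSMulRegular B (φ a) := IsSMulRegular.of_flat (S := B) (x := a) ha
  refine ⟨d, hreg ?_⟩
  simpa using hc
end
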